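/- With 𝒫, P, μ, 𝒜, 𝒪, w, 𝒯, ℱ as in the persistence setting, with w additive: for all objects M• and N• in 𝒯^𝒯_{𝒪,μ,w̲_ℱ}, ∫_P | w̲_ℱ(M•) − w̲_ℱ(N•) | dμ ≤ d_{μ∘w̲_ℱ}(M•, N•) ≤ ∫_P ( w̲_ℱ(M•) + w̲_ℱ(N•) ) dμ. -/

import Mathlib

open CategoryTheory CategoryTheory.Limits CategoryTheory.Pretriangulated ZeroObject
open MeasureTheory
open scoped ENNReal NNReal

universe v u v₂ u₂

namespace ExactWeightsTriangulated

variable {C : Type u} [Category.{v} C] [HasZeroObject C] [Preadditive C] [HasShift C ℤ]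
  [∀ n : ℤ, (CategoryTheory.shiftFunctor C n).Additive] [Pretriangulated C]

/-- A zigzag of morphisms from `X` to `Y`, each equipped with a chosen cone lying in the
class `S` (i.e. each morphism belongs to `ℳ(S)`). -/
inductive ConeZigzag (S : Set C) : C → C → Type (max u v)
  | nil (X : C) : ConeZigzag S X X
  | fwd {X Y W : C} (f : X ⟶ Y) (Z : C) (g : Y ⟶ Z) (h : Z ⟶ X⟦(1 : ℤ)⟧)
      (hZ : Z ∈ S) (hT : Triangle.mk f g h ∈ distTriang C)
      (rest : ConeZigzag S Y W) : ConeZigzag S X W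
  | bwd {X Y W : C} (f : Y ⟶ X) (Z : C) (g : X ⟶ Z) (h : Z ⟶ Y⟦(1 : ℤ)⟧)
      (hZ : Z ∈ S) (hT : Triangle.mk f g h ∈ distTriang C)
      (rest : ConeZigzag S Y W) : ConeZigzag S X W

/-- The cost of a zigzag: the sum of the weights of the cones of its morphisms. -/
noncomputable def cost {S : Set C} (w : C → ℝ≥0∞) : ∀ {X Y : C}, ConeZigzag S X Y → ℝ≥0∞
  | _, _, .nil _ => 0
  | _, _, .fwd _ Z _ _ _ _ rest => w Z + cost w rest
  | _, _, .bwd _ Z _ _ _ _ rest => w Z + cost w rest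

/-- The path metric `d_w` associated to the weight `w` on the class `S`:
the infimum of the costs of `ℳ(S)`-zigzags from `X` to `Y`. -/
noncomputable def pathDist (S : Set C) (w : C → ℝ≥0∞) (X Y : C) : ℝ≥0∞ :=
  ⨅ (γ : ConeZigzag S X Y), cost w γ

variable {A : Type u₂} [Category.{v₂} A] [Abelian A]

/-- A class of objects `O` of an abelian category is closed under kernels and cokernels if
for every morphism between objects of `O`, both its kernel and its cokernel lie in `O`. -/
def ClosedUnderKerCoker (O : Set A) : Prop :=
  ∀ ⦃X Y : A⦄ (f : X ⟶ Y), X ∈ O → Y ∈ O → kernel f ∈ O ∧ cokernel f ∈ O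

/-- A weight `w` on a class `O` of objects of an abelian category is *additive* if for every
short exact sequence `0 → A → B → C → 0` with all terms in `O`, `w B = w A + w C`. -/
def IsAdditiveWeight (O : Set A) (w : A → ℝ≥0) : Prop :=
  ∀ (Sc : ShortComplex A), Sc.ShortExact → Sc.X₁ ∈ O → Sc.X₂ ∈ O → Sc.X₃ ∈ O →
    w Sc.X₂ = w Sc.X₁ + w Sc.X₃

/-- The class `ℒ_{𝒯, F, 𝒪, w}` of objects `X` of `𝒯` such that `F^i(X) = F(X⟦i⟧)` lies in
`𝒪` for every `i : ℤ` (with finite weight, which is automatic here), and `F^i(X) ≠ 0` for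
only finitely many `i`. -/
def LClass (F : C ⥤ A) (O : Set A) : Set C :=
  {X | (∀ i : ℤ, F.obj (X⟦i⟧) ∈ O) ∧ {i : ℤ | ¬ IsZero (F.obj (X⟦i⟧))}.Finite}

/-- The weight `w̲_F` induced on `ℒ_{𝒯, F, 𝒪, w}` by a weight `w` and a (co)homological
functor `F`: `w̲_F(X) = |∑ i, (-1)^i w (F^i X)|`. -/
noncomputable def inducedWeight (F : C ⥤ A) (w : A → ℝ≥0) (X : C) : ℝ :=
  |∑ᶠ i : ℤ, (-1 : ℝ) ^ i * (w (F.obj (X⟦i⟧)) : ℝ)|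

section Persistence

/-- The triangulated category of persistence modules under consideration: the homotopy
category `K(𝒜^𝒫)` of complexes of persistence modules `𝒫 ⥤ 𝒜`. (The derived category
`D(𝒜^𝒫)` is treated in the same way.) -/
abbrev PersCat (P : Type) [SmallCategory P] (A : Type u₂) [Category.{v₂} A] [Abelian A] :=
  HomotopyCategory (P ⥤ A) (ComplexShape.up ℤ)

variable {P : Type} [SmallCategory P] {A : Type u₂} [Category.{v₂} A] [Abelian A]

/-- The weight `w̲_ℱ(M)(p) = w̲_{F_p}(M)` induced by a family `ℱ = {F_p}` of homological
functors. -/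
noncomputable def familyWeight (F : ∀ _ : P, PersCat P A ⥤ A) (w : A → ℝ≥0)
    (M : PersCat P A) (p : P) : ℝ :=
  inducedWeight (F p) w M

variable [MeasurableSpace P]

/-- The class `𝒯^𝒯_{𝒪, μ, w̲_ℱ}` of objects lying in `ℒ_p` for all `p ∈ P` and whose
induced weight function `p ↦ w̲_ℱ(M)(p)` is `μ`-integrable. -/
def TTClass (F : ∀ _ : P, PersCat P A ⥤ A) (O : Set A) (w : A → ℝ≥0) (μ : Measure P) :
    Set (PersCat P A) :=
  {M | (∀ p : P, M ∈ LClass (F p) O) ∧ Integrable (fun p : P => familyWeight F w M p) μ}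

/-- The weight `μ ∘ w̲_ℱ : M ↦ ∫_P w̲_ℱ(M) dμ`. -/
noncomputable def muWeight (F : ∀ _ : P, PersCat P A ⥤ A) (w : A → ℝ≥0) (μ : Measure P)
    (M : PersCat P A) : ℝ :=
  ∫ p : P, familyWeight F w M p ∂μ

end Persistence

section FilteredWeight

/-- `IsoWeight O w X r` says that `X` is isomorphic to an object of `O` of weight `r`. -/
def IsoWeight (O : Set A) (w : A → ℝ≥0) (X : A) (r : ℝ) : Prop :=
  ∃ Y ∈ O, Nonempty (Y ≅ X) ∧ r = w Y

/-- `FilteredWeight O w X r` says that `X` is an iterated extension of objects isomorphic to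
objects of `O` whose weights add up to `r`. -/
inductive FilteredWeight (O : Set A) (w : A → ℝ≥0) : A → ℝ → Prop
  | of {X : A} {r : ℝ} (h : IsoWeight O w X r) : FilteredWeight O w X r
  | ext {X Y Z : A} {r s : ℝ} (f : X ⟶ Y) (g : Y ⟶ Z) (zero : f ≫ g = 0)
      (hS : (ShortComplex.mk f g zero).ShortExact)
      (hX : FilteredWeight O w X r) (hZ : FilteredWeight O w Z s) : FilteredWeight O w Y (r + s)

variable {O : Set A} {w : A → ℝ≥0}

set_option linter.unusedSectionVars false in
lemma IsoWeight.of_iso {X Y : A} {r : ℝ} (h : IsoWeight O w X r) (e : X ≅ Y) :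
    IsoWeight O w Y r := by
  obtain ⟨Z, hZ, ⟨i⟩, rfl⟩ := h
  exact ⟨Z, hZ, ⟨i ≪≫ e⟩, rfl⟩

lemma FilteredWeight.of_iso {X Y : A} {r : ℝ} (h : FilteredWeight O w X r) (e : X ≅ Y) :
    FilteredWeight O w Y r := by
  induction h generalizing Y with
  | of h => exact .of (h.of_iso e)
  | ext f g zero hS hX hZ _ _ =>
    refine .ext (f ≫ e.hom) (e.inv ≫ g) (by simp [zero]) ?_ hX hZ
    refine ShortComplex.shortExact_of_iso ?_ hS
    exact ShortComplex.isoMk (Iso.refl _) e (Iso.refl _) (by simp) (by simp)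

/-- An additive weight vanishes on zero objects. -/
lemma FilteredWeight.eq_zero_of_isZero (hadd : IsAdditiveWeight O w) {X : A} {r : ℝ}
    (h : FilteredWeight O w X r) (hX : IsZero X) : r = 0 := by
  induction h with
  | of h =>
    obtain ⟨Y, hY, ⟨i⟩, rfl⟩ := h
    have hY0 : IsZero Y := hX.of_iso i
    have hS : (ShortComplex.mk (0 : Y ⟶ Y) (0 : Y ⟶ Y) (by simp)).ShortExact :=
      { exact := ShortComplex.exact_of_isZero_X₂ _ hY0
        mono_f := hY0.mono _
        epi_g := hY0.epi _ }
    have := hadd _ hS hY hY hY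
    simpa using this
  | ext f g zero hS _ _ ih₁ ih₂ =>
    have := hS.mono_f
    have := hS.epi_g
    rw [ih₁ (IsZero.of_mono f hX), ih₂ (IsZero.of_epi g hX), add_zero]

/-- The middle term of a five-term exact sequence is an extension of a kernel by a cokernel. -/
lemma FilteredWeight.of_exact {X₁ X₂ X₃ X₄ X₅ : A} {a : X₁ ⟶ X₂} {b : X₂ ⟶ X₃} {c : X₃ ⟶ X₄}
    {d : X₄ ⟶ X₅} {hab : a ≫ b = 0} {hbc : b ≫ c = 0} {hcd : c ≫ d = 0}
    (h₂ : (ShortComplex.mk a b hab).Exact) (h₃ : (ShortComplex.mk b c hbc).Exact)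
    (h₄ : (ShortComplex.mk c d hcd).Exact) {r s : ℝ}
    (hr : FilteredWeight O w (cokernel a) r) (hs : FilteredWeight O w (kernel d) s) :
    FilteredWeight O w X₃ (r + s) := by
  have hm : Mono (cokernel.desc a b hab) := h₂.mono_cokernelDesc
  have he : Epi (kernel.lift d c hcd) := h₄.epi_kernelLift
  have zero₁ : cokernel.desc a b hab ≫ c = 0 := by
    rw [← cancel_epi (cokernel.π a)]; simp [hbc]
  have zero₂ : cokernel.desc a b hab ≫ kernel.lift d c hcd = 0 := by
    rw [← cancel_mono (kernel.ι d)]; simp [zero₁]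
  refine .ext _ _ zero₂ { exact := ?_, mono_f := hm, epi_g := he } hr hs
  let φ : ShortComplex.mk b c hbc ⟶ ShortComplex.mk _ c zero₁ :=
    { τ₁ := cokernel.π a, τ₂ := 𝟙 _, τ₃ := 𝟙 _ }
  let ψ : ShortComplex.mk _ _ zero₂ ⟶ ShortComplex.mk _ c zero₁ :=
    { τ₁ := 𝟙 _, τ₂ := 𝟙 _, τ₃ := kernel.ι d }
  have : Epi φ.τ₁ := inferInstanceAs (Epi (cokernel.π a))
  have : IsIso φ.τ₂ := inferInstanceAs (IsIso (𝟙 _))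
  have : Mono φ.τ₃ := inferInstanceAs (Mono (𝟙 _))
  have : Epi ψ.τ₁ := inferInstanceAs (Epi (𝟙 _))
  have : IsIso ψ.τ₂ := inferInstanceAs (IsIso (𝟙 _))
  have : Mono ψ.τ₃ := inferInstanceAs (Mono (kernel.ι d))
  exact (ShortComplex.exact_iff_of_epi_of_isIso_of_mono ψ).2
    ((ShortComplex.exact_iff_of_epi_of_isIso_of_mono φ).1 h₃)

lemma IsoWeight.kernel_cokernel (hker : ClosedUnderKerCoker O) (hadd : IsAdditiveWeight O w)
    {X Y : A} {r s : ℝ} (hX : IsoWeight O w X r) (hY : IsoWeight O w Y s) (f : X ⟶ Y) :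
    ∃ k c : ℝ, IsoWeight O w (kernel f) k ∧ IsoWeight O w (cokernel f) c ∧ r - s = k - c := by
  obtain ⟨X', hX', ⟨i⟩, rfl⟩ := hX
  obtain ⟨Y', hY', ⟨j⟩, rfl⟩ := hY
  let f' : X' ⟶ Y' := i.hom ≫ f ≫ j.inv
  obtain ⟨hK, hQ⟩ := hker f' hX' hY'
  have hI : Abelian.coimage f' ∈ O := (hker (kernel.ι f') hK hX').2
  refine ⟨w (kernel f'), w (cokernel f'),
    ⟨_, hK, ⟨kernel.mapIso f' f i j (by simp [f'])⟩, rfl⟩,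
    ⟨_, hQ, ⟨cokernel.mapIso f' f i j (by simp [f'])⟩, rfl⟩, ?_⟩
  have h₁ : (ShortComplex.mk (kernel.ι f') (cokernel.π (kernel.ι f')) (by simp)).ShortExact :=
    { exact := ShortComplex.exact_cokernel _
      mono_f := inferInstance
      epi_g := inferInstance }
  have zero : Abelian.factorThruCoimage f' ≫ cokernel.π f' = 0 := by
    rw [← cancel_epi (Abelian.coimage.π f')]
    simp
  have h₂ : (ShortComplex.mk _ _ zero).ShortExact :=
    { exact := by
        let φ : ShortComplex.mk f' (cokernel.π f') (by simp) ⟶ ShortComplex.mk _ _ zero :=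
          { τ₁ := Abelian.coimage.π f', τ₂ := 𝟙 _, τ₃ := 𝟙 _ }
        have : Epi φ.τ₁ := inferInstanceAs (Epi (Abelian.coimage.π f'))
        have : IsIso φ.τ₂ := inferInstanceAs (IsIso (𝟙 _))
        have : Mono φ.τ₃ := inferInstanceAs (Mono (𝟙 _))
        exact (ShortComplex.exact_iff_of_epi_of_isIso_of_mono φ).1
          (ShortComplex.exact_cokernel _)
      mono_f := inferInstance
      epi_g := inferInstance }
  have e₁ := hadd _ h₁ hK hX' hI
  have e₂ := hadd _ h₂ hI hY' hQ
  dsimp at e₁ e₂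
  rw [e₁, e₂]
  push_cast
  ring

lemma IsoWeight.kernel_cokernel_filteredWeight (hker : ClosedUnderKerCoker O)
    (hadd : IsAdditiveWeight O w) {X Y : A} {r s : ℝ} (hX : IsoWeight O w X r)
    (hY : FilteredWeight O w Y s) (f : X ⟶ Y) :
    ∃ k c : ℝ, IsoWeight O w (kernel f) k ∧ FilteredWeight O w (cokernel f) c ∧
      r - s = k - c := by
  induction hY generalizing X r with
  | of hY =>
    obtain ⟨k, c, hk, hc, h⟩ := hX.kernel_cokernel hker hadd hY f
    exact ⟨k, c, hk, .of hc, h⟩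
  | @ext Y₁ Y Y₃ s₁ s₃ a g zero hS _ _ ih₁ ih₃ =>
    have hg : Epi g := hS.epi_g
    obtain ⟨k, c, hk, hc, h⟩ := ih₃ hX (f ≫ g)
    let T := kernelCokernelCompSequence.snakeInput f g
    let e : Y₁ ≅ kernel g := hS.fIsKernel.conePointUniqueUpToIso (limit.isLimit _)
    let α : kernel (f ≫ g) ⟶ kernel g := T.L₀.g
    obtain ⟨k', c', hk', hc', h'⟩ := ih₁ hk (α ≫ e.inv)
    have hm : Mono T.L₀.f := inferInstanceAs (Mono (kernel.map f (f ≫ g) (𝟙 _) g (by simp)))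
    let i : kernel f ≅ kernel α :=
      T.L₀_exact.fIsKernel.conePointUniqueUpToIso (limit.isLimit _)
    have hd : T.L₃.g = 0 := (isZero_cokernel_of_epi g).eq_of_tgt _ _
    let j : kernel T.L₃.g ≅ cokernel (f ≫ g) := kernelIsoOfEq hd ≪≫ kernelZeroIsoSource
    refine ⟨k', c' + c, hk'.of_iso (kernelCompMono α e.inv ≪≫ i.symm), ?_, by linarith⟩
    exact .of_exact T.L₁'_exact T.L₂'_exact T.L₃_exact
      (hc'.of_iso (cokernelCompIsIso α e.inv)) (hc.of_iso j.symm)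

/-- The iterated extensions of objects of a class closed under kernels and cokernels are again
closed under kernels and cokernels, and weights behave additively. -/
lemma FilteredWeight.kernel_cokernel (hker : ClosedUnderKerCoker O)
    (hadd : IsAdditiveWeight O w) {X Y : A} {r s : ℝ} (hX : FilteredWeight O w X r)
    (hY : FilteredWeight O w Y s) (f : X ⟶ Y) :
    ∃ k c : ℝ, FilteredWeight O w (kernel f) k ∧ FilteredWeight O w (cokernel f) c ∧
      r - s = k - c := by
  induction hX generalizing Y s with
  | of hX =>
    obtain ⟨k, c, hk, hc, h⟩ := hX.kernel_cokernel_filteredWeight hker hadd hY f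
    exact ⟨k, c, .of hk, hc, h⟩
  | @ext X₁ X X₃ r₁ r₃ a g zero hS _ _ ih₁ ih₃ =>
    have ha : Mono a := hS.mono_f
    obtain ⟨k, c, hk, hc, h⟩ := ih₁ hY (a ≫ f)
    let T := kernelCokernelCompSequence.snakeInput a f
    let e : X₃ ≅ cokernel a := hS.gIsCokernel.coconePointUniqueUpToIso (colimit.isColimit _)
    let β : cokernel a ⟶ cokernel (a ≫ f) := T.L₃.f
    obtain ⟨k', c', hk', hc', h'⟩ := ih₃ hc (e.hom ≫ β)
    have he : Epi T.L₃.g := inferInstanceAs (Epi (cokernel.map (a ≫ f) f a (𝟙 _) (by simp)))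
    let i : cokernel f ≅ cokernel β :=
      T.L₃_exact.gIsCokernel.coconePointUniqueUpToIso (colimit.isColimit _)
    have hd : T.L₀.f = 0 := (isZero_kernel_of_mono a).eq_of_src _ _
    let j : cokernel T.L₀.f ≅ kernel (a ≫ f) := cokernelIsoOfEq hd ≪≫ cokernelZeroIsoTarget
    refine ⟨k + k', c', ?_, hc'.of_iso (cokernelEpiComp e.hom β ≪≫ i.symm), by linarith⟩
    exact .of_exact T.L₀_exact T.L₁'_exact T.L₂'_exact
      (hk.of_iso j.symm) (hk'.of_iso (kernelIsIsoComp e.hom β))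

lemma FilteredWeight.unique (hker : ClosedUnderKerCoker O) (hadd : IsAdditiveWeight O w)
    {X : A} {r s : ℝ} (hr : FilteredWeight O w X r) (hs : FilteredWeight O w X s) : r = s := by
  obtain ⟨k, c, hk, hc, h⟩ := hr.kernel_cokernel hker hadd hs (𝟙 X)
  have hk0 := hk.eq_zero_of_isZero hadd (isZero_kernel_of_mono _)
  have hc0 := hc.eq_zero_of_isZero hadd (isZero_cokernel_of_epi _)
  linarith

/-- The family `X` has finitely many nonzero terms, and `r` records their weights. -/
def GradedWeight (O : Set A) (w : A → ℝ≥0) (X : ℤ → A) (r : ℤ → ℝ) : Prop :=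
  (∀ i, FilteredWeight O w (X i) (r i)) ∧ {i | ¬ IsZero (X i)}.Finite

/-- The Euler characteristic of a family of weights. -/
noncomputable def eulerSum (r : ℤ → ℝ) : ℝ := ∑ᶠ i : ℤ, (-1 : ℝ) ^ i * r i

lemma eulerSum_add {r s : ℤ → ℝ} (hr : r.support.Finite) (hs : s.support.Finite) :
    eulerSum (fun i => r i + s i) = eulerSum r + eulerSum s := by
  simp only [eulerSum, mul_add]
  exact finsum_add_distrib (hr.subset (Function.support_mul_subset_right _ _))
    (hs.subset (Function.support_mul_subset_right _ _))

lemma eulerSum_sub {r s : ℤ → ℝ} (hr : r.support.Finite) (hs : s.support.Finite) :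
    eulerSum (fun i => r i - s i) = eulerSum r - eulerSum s := by
  simp only [eulerSum, mul_sub]
  exact finsum_sub_distrib (hr.subset (Function.support_mul_subset_right _ _))
    (hs.subset (Function.support_mul_subset_right _ _))

lemma eulerSum_comp_add_one (r : ℤ → ℝ) : eulerSum (fun i => r (i + 1)) = -eulerSum r := by
  have h : ∀ i : ℤ, (-1 : ℝ) ^ i * r (i + 1) = -((-1 : ℝ) ^ (i + 1) * r (i + 1)) := by
    intro i
    rw [zpow_add_one₀ (by norm_num)]
    ring
  simp only [eulerSum, h, finsum_neg_distrib]
  exact congrArg Neg.neg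
    (finsum_comp_equiv (Equiv.addRight (1 : ℤ)) (f := fun i => (-1 : ℝ) ^ i * r i))

lemma GradedWeight.finite_support (hadd : IsAdditiveWeight O w) {X : ℤ → A} {r : ℤ → ℝ}
    (h : GradedWeight O w X r) : r.support.Finite :=
  h.2.subset fun i hi hX => hi ((h.1 i).eq_zero_of_isZero hadd hX)

lemma GradedWeight.comp_add_one {X : ℤ → A} {r : ℤ → ℝ} (h : GradedWeight O w X r) :
    GradedWeight O w (fun i => X (i + 1)) (fun i => r (i + 1)) :=
  ⟨fun i => h.1 (i + 1), h.2.preimage (f := fun i : ℤ => i + 1) (add_left_injective 1).injOn⟩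

/-- In a long exact sequence the middle family inherits a graded weight from the outer ones, and
Euler characteristics are additive. -/
lemma GradedWeight.of_longExact (hker : ClosedUnderKerCoker O) (hadd : IsAdditiveWeight O w)
    {X Y Z : ℤ → A} {a : ∀ i, X i ⟶ Y i} {b : ∀ i, Y i ⟶ Z i} {d : ∀ i, Z i ⟶ X (i + 1)}
    {hab : ∀ i, a i ≫ b i = 0} {hbd : ∀ i, b i ≫ d i = 0} {hda : ∀ i, d i ≫ a (i + 1) = 0}
    (hX : ∀ i, (ShortComplex.mk _ _ (hda i)).Exact)
    (hY : ∀ i, (ShortComplex.mk _ _ (hab i)).Exact)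
    (hZ : ∀ i, (ShortComplex.mk _ _ (hbd i)).Exact)
    {r t : ℤ → ℝ} (hr : GradedWeight O w X r) (ht : GradedWeight O w Z t) :
    ∃ s, GradedWeight O w Y s ∧ eulerSum s = eulerSum r + eulerSum t := by
  choose k c hk hc h using
    fun i => (ht.1 i).kernel_cokernel hker hadd (hr.1 (i + 1)) (d i)
  have hkf : k.support.Finite := ht.2.subset fun i hi hZi =>
    hi ((hk i).eq_zero_of_isZero hadd (IsZero.of_mono (kernel.ι (d i)) hZi))
  have hcf : c.support.Finite := hr.comp_add_one.2.subset fun i hi hXi =>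
    hi ((hc i).eq_zero_of_isZero hadd (IsZero.of_epi (cokernel.π (d i)) hXi))
  have hcf' : (fun i => c (i - 1)).support.Finite :=
    hcf.preimage (f := fun i : ℤ => i - 1) (sub_left_injective (b := 1)).injOn
  refine ⟨fun i => c (i - 1) + k i, ⟨fun i => ?_, ?_⟩, ?_⟩
  · obtain ⟨j, rfl⟩ : ∃ j, i = j + 1 := ⟨i - 1, by ring⟩
    simp only [add_sub_cancel_right]
    exact .of_exact (hX j) (hY (j + 1)) (hZ (j + 1)) (hc j) (hk (j + 1))
  · refine (hr.2.union ht.2).subset fun i hi => ?_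
    by_contra hn
    simp only [Set.mem_union, Set.mem_ofPred_eq, not_or, not_not] at hn
    exact hi ((hY i).isZero_of_both_zeros (hn.1.eq_of_src _ _) (hn.2.eq_of_tgt _ _))
  · rw [eulerSum_add hcf' hkf]
    have h₁ := eulerSum_comp_add_one fun i => c (i - 1)
    simp only [add_sub_cancel_right] at h₁
    have h₂ : eulerSum (fun i => t i - r (i + 1)) = eulerSum (fun i => k i - c i) := by
      simp only [h]
    rw [eulerSum_sub (ht.finite_support hadd) (hr.comp_add_one.finite_support hadd),
      eulerSum_sub hkf hcf, eulerSum_comp_add_one] at h₂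
    linarith

lemma GradedWeight.eulerSum_eq (hker : ClosedUnderKerCoker O) (hadd : IsAdditiveWeight O w)
    {X : ℤ → A} {r s : ℤ → ℝ} (hr : GradedWeight O w X r) (hs : GradedWeight O w X s) :
    eulerSum r = eulerSum s := by
  have : r = s := funext fun i => (hr.1 i).unique hker hadd (hs.1 i)
  rw [this]

end FilteredWeight

section Triangles

variable {O : Set A} {w : A → ℝ≥0}

set_option linter.unusedSectionVars false in
lemma gradedWeight_of_mem_LClass {F : C ⥤ A} {X : C} (hX : X ∈ LClass F O) :
    GradedWeight O w (fun i : ℤ => F.obj (X⟦i⟧)) (fun i => w (F.obj (X⟦i⟧))) :=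
  ⟨fun i => .of ⟨_, hX.1 i, ⟨Iso.refl _⟩, rfl⟩, hX.2⟩

lemma exists_gradedWeight_obj₂ (hker : ClosedUnderKerCoker O) (hadd : IsAdditiveWeight O w)
    (F : C ⥤ A) [F.IsHomological] {T : Triangle C} (hT : T ∈ distTriang C) {r t : ℤ → ℝ}
    (hr : GradedWeight O w (fun i : ℤ => F.obj (T.obj₁⟦i⟧)) r)
    (ht : GradedWeight O w (fun i : ℤ => F.obj (T.obj₃⟦i⟧)) t) :
    ∃ s, GradedWeight O w (fun i : ℤ => F.obj (T.obj₂⟦i⟧)) s ∧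
      eulerSum s = eulerSum r + eulerSum t := by
  let _ := Functor.ShiftSequence.tautological F ℤ
  exact GradedWeight.of_longExact hker hadd
    (fun i => F.homologySequence_exact₁ T hT i (i + 1) rfl)
    (fun i => F.homologySequence_exact₂ T hT i)
    (fun i => F.homologySequence_exact₃ T hT i (i + 1) rfl) hr ht

lemma exists_gradedWeight_obj₁ (hker : ClosedUnderKerCoker O) (hadd : IsAdditiveWeight O w)
    (F : C ⥤ A) [F.IsHomological] {T : Triangle C} (hT : T ∈ distTriang C) {s t : ℤ → ℝ}
    (hs : GradedWeight O w (fun i : ℤ => F.obj (T.obj₂⟦i⟧)) s)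
    (ht : GradedWeight O w (fun i : ℤ => F.obj (T.obj₃⟦i⟧)) t) :
    ∃ r, GradedWeight O w (fun i : ℤ => F.obj (T.obj₁⟦i⟧)) r ∧
      eulerSum s = eulerSum r + eulerSum t := by
  let _ := Functor.ShiftSequence.tautological F ℤ
  obtain ⟨q, hq, h⟩ := GradedWeight.of_longExact hker hadd
    (X := fun i : ℤ => (F.shift i).obj T.obj₃) (Y := fun i : ℤ => (F.shift (i + 1)).obj T.obj₁)
    (Z := fun i : ℤ => (F.shift (i + 1)).obj T.obj₂)
    (fun i => F.homologySequence_exact₃ T hT (i + 1) (i + 1 + 1) rfl)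
    (fun i => F.homologySequence_exact₁ T hT i (i + 1) rfl)
    (fun i => F.homologySequence_exact₂ T hT (i + 1)) ht hs.comp_add_one
  have h₁ := eulerSum_comp_add_one fun i => q (i - 1)
  simp only [add_sub_cancel_right] at h₁
  rw [eulerSum_comp_add_one] at h
  refine ⟨fun i => q (i - 1), ⟨fun i => ?_, ?_⟩, by linarith⟩
  · obtain ⟨j, rfl⟩ : ∃ j, i = j + 1 := ⟨i - 1, by ring⟩
    simp only [add_sub_cancel_right]
    exact hq.1 j
  · refine (hq.2.image fun i => i + 1).subset fun i hi => ⟨i - 1, ?_, by simp⟩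
    obtain ⟨j, rfl⟩ : ∃ j, i = j + 1 := ⟨i - 1, by ring⟩
    rw [add_sub_cancel_right]
    exact hi

/-- The sum of the values of a real-valued weight on the cones of a zigzag. -/
noncomputable def realCost {S : Set C} (v : C → ℝ) : ∀ {X Y : C}, ConeZigzag S X Y → ℝ
  | _, _, .nil _ => 0
  | _, _, .fwd _ Z _ _ _ _ rest => v Z + realCost v rest
  | _, _, .bwd _ Z _ _ _ _ rest => v Z + realCost v rest

lemma abs_abs_eulerSum_sub_le_realCost (hker : ClosedUnderKerCoker O)
    (hadd : IsAdditiveWeight O w) (F : C ⥤ A) [F.IsHomological] {S : Set C}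
    (hS : S ⊆ LClass F O) {X Y : C} (γ : ConeZigzag S X Y) {r s : ℤ → ℝ}
    (hr : GradedWeight O w (fun i : ℤ => F.obj (X⟦i⟧)) r)
    (hs : GradedWeight O w (fun i : ℤ => F.obj (Y⟦i⟧)) s) :
    |(|eulerSum r| - |eulerSum s|)| ≤ realCost (inducedWeight F w) γ := by
  induction γ generalizing r with
  | nil X => simp [hr.eulerSum_eq hker hadd hs, realCost]
  | fwd f Z g h hZ hT rest ih =>
    obtain ⟨q, hq, e⟩ := exists_gradedWeight_obj₂ hker hadd F hT hr
      (gradedWeight_of_mem_LClass (hS hZ))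
    have h₁ := abs_abs_sub_abs_le_abs_sub (eulerSum r) (eulerSum q)
    have h₂ : |eulerSum r - eulerSum q| = inducedWeight F w Z := by
      rw [e, sub_add_cancel_left, abs_neg]; rfl
    have h₃ := abs_sub_le |eulerSum r| |eulerSum q| |eulerSum s|
    have h₄ := ih hq hs
    simp only [realCost]
    linarith
  | bwd f Z g h hZ hT rest ih =>
    obtain ⟨q, hq, e⟩ := exists_gradedWeight_obj₁ hker hadd F hT hr
      (gradedWeight_of_mem_LClass (hS hZ))
    have h₁ := abs_abs_sub_abs_le_abs_sub (eulerSum r) (eulerSum q)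
    have h₂ : |eulerSum r - eulerSum q| = inducedWeight F w Z := by
      rw [e, add_sub_cancel_left]; rfl
    have h₃ := abs_sub_le |eulerSum r| |eulerSum q| |eulerSum s|
    have h₄ := ih hq hs
    simp only [realCost]
    linarith

/-- The weight induced by a homological functor is 1-Lipschitz along zigzags. -/
lemma abs_inducedWeight_sub_le_realCost (hker : ClosedUnderKerCoker O)
    (hadd : IsAdditiveWeight O w) (F : C ⥤ A) [F.IsHomological] {S : Set C}
    (hS : S ⊆ LClass F O) {X Y : C} (γ : ConeZigzag S X Y) (hX : X ∈ LClass F O)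
    (hY : Y ∈ LClass F O) :
    |inducedWeight F w X - inducedWeight F w Y| ≤ realCost (inducedWeight F w) γ :=
  abs_abs_eulerSum_sub_le_realCost hker hadd F hS γ
    (gradedWeight_of_mem_LClass hX) (gradedWeight_of_mem_LClass hY)

end Triangles

section Persistence

variable {P : Type} [SmallCategory P] {A : Type u₂} [Category.{v₂} A] [Abelian A]
  [MeasurableSpace P]

lemma muWeight_nonneg (F : ∀ _ : P, PersCat P A ⥤ A) (w : A → ℝ≥0) (μ : Measure P)
    (M : PersCat P A) : 0 ≤ muWeight F w μ M :=
  integral_nonneg fun _ => abs_nonneg _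

/-- The cost of a zigzag for `μ ∘ w̲_ℱ` is the integral of its pointwise costs. -/
lemma integrable_realCost_and_cost_eq {F : ∀ _ : P, PersCat P A ⥤ A} {O : Set A} {w : A → ℝ≥0}
    {μ : Measure P} {M N : PersCat P A} (γ : ConeZigzag (TTClass F O w μ) M N) :
    Integrable (fun p => realCost (inducedWeight (F p) w) γ) μ ∧
      cost (fun X => ENNReal.ofReal (muWeight F w μ X)) γ =
        ENNReal.ofReal (∫ p, realCost (inducedWeight (F p) w) γ ∂μ) ∧
      0 ≤ ∫ p, realCost (inducedWeight (F p) w) γ ∂μ := by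
  induction γ with
  | nil X => simp [realCost, cost]
  | fwd f Z g h hZ hT rest ih | bwd f Z g h hZ hT rest ih =>
    have hI : Integrable (fun p => inducedWeight (F p) w Z) μ := hZ.2
    have hnn := muWeight_nonneg F w μ Z
    simp only [realCost, cost]
    rw [integral_add hI ih.1, ih.2.1, ← ENNReal.ofReal_add hnn ih.2.2]
    exact ⟨hI.add ih.1, rfl, add_nonneg hnn ih.2.2⟩

end Persistence

/-- Theorem 3.8: two-sided bound for the path metric associated to `μ ∘ w̲_ℱ`. -/
theorem pathDist_muWeight_bounds {P : Type} [SmallCategory P] [MeasurableSpace P]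
    {A : Type u₂} [Category.{v₂} A] [Abelian A]
    (F : ∀ _ : P, PersCat P A ⥤ A) (hF : ∀ p : P, (F p).IsHomological)
    (O : Set A) (w : A → ℝ≥0)
    (hker : ClosedUnderKerCoker O) (hadd : IsAdditiveWeight O w)
    (μ : Measure P) (M N : PersCat P A)
    (hM : M ∈ TTClass F O w μ) (hN : N ∈ TTClass F O w μ) :
    ENNReal.ofReal (∫ p : P, |familyWeight F w M p - familyWeight F w N p| ∂μ) ≤
      pathDist (TTClass F O w μ) (fun X => ENNReal.ofReal (muWeight F w μ X)) M N ∧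
    pathDist (TTClass F O w μ) (fun X => ENNReal.ofReal (muWeight F w μ X)) M N ≤
      ENNReal.ofReal (∫ p : P, (familyWeight F w M p + familyWeight F w N p) ∂μ) := by
  constructor
  · refine le_iInf fun γ => ?_
    obtain ⟨hI, hcost, -⟩ := integrable_realCost_and_cost_eq γ
    rw [hcost]
    refine ENNReal.ofReal_le_ofReal (integral_mono (hM.2.sub hN.2).abs hI fun p => ?_)
    have := hF p
    exact abs_inducedWeight_sub_le_realCost hker hadd (F p) (fun Z hZ => hZ.1 p) γ
      (hM.1 p) (hN.1 p)
  · refine (iInf_le _ (.bwd 0 M (𝟙 M) 0 hM (contractible_distinguished₁ M)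
      (.fwd 0 N (𝟙 N) 0 hN (contractible_distinguished₁ N) (.nil N)))).trans (le_of_eq ?_)
    simp only [cost, add_zero]
    rw [← ENNReal.ofReal_add (muWeight_nonneg F w μ M) (muWeight_nonneg F w μ N),
      integral_add hM.2 hN.2]
    rfl


end ExactWeightsTriangulated
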